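/- Under the conditions of the mixed-state model ρ(θ) = w(θ)ρ₁(θ) + (1 − w(θ))ρ₂(θ) with orthonormal pure components and |ψ₂⟩ = I₁^{−1/2} ρ₁_{//θ}|ψ₁⟩, the quantum information I(θ) = tr(ρ ρ_{//θ}²) equals (w_{/θ})²/(w(1 − w)) + (2w − 1)² I₁(θ), where I₁(θ) = 2 tr(ρ₁_{/θ}²). -/

import Mathlib

open Matrix

/-- The rank-one projections onto an orthonormal pair in `ℂ²` sum to the identity. -/
lemma vecMulVec_star_add_vecMulVec_star_eq_one {x y : Fin 2 → ℂ}
    (hx : star x ⬝ᵥ x = 1) (hy : star y ⬝ᵥ y = 1) (hxy : star x ⬝ᵥ y = 0) :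
    vecMulVec x (star x) + vecMulVec y (star y) = 1 := by
  have hyx : star y ⬝ᵥ x = 0 := by rw [star_dotProduct, hxy, star_zero]
  have hU : (of ![x, y]).map star * (of ![x, y])ᵀ = 1 := by
    ext i j
    simp only [dotProduct, Fin.sum_univ_two, Pi.star_apply] at hx hy hxy hyx
    fin_cases i <;> fin_cases j <;> simpa [mul_apply, Fin.sum_univ_two]
  rw [mul_eq_one_comm] at hU
  rw [← hU]
  ext i j
  simp [mul_apply, vecMulVec_apply, Fin.sum_univ_two]

lemma vecMulVec_star_mul_self {n : Type*} [Fintype n] {x : n → ℂ} (hx : star x ⬝ᵥ x = 1) :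
    vecMulVec x (star x) * vecMulVec x (star x) = vecMulVec x (star x) := by
  rw [vecMulVec_mul_vecMulVec, hx, one_smul]

/-- The entrywise derivative of a curve of idempotent matrices. -/
lemma eq_mul_add_mul_of_hasDerivAt_of_isIdempotentElem {n : Type*} [Fintype n]
    {P : ℝ → Matrix n n ℂ} {D : Matrix n n ℂ} {θ : ℝ} (hP : ∀ t, P t * P t = P t)
    (hD : ∀ i j, HasDerivAt (fun t => P t i j) (D i j) θ) :
    D = D * P θ + P θ * D := by
  ext i j
  refine (hD i j).unique ?_
  have h := HasDerivAt.fun_sum (u := Finset.univ) fun k _ => (hD i k).mul (hD k j)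
  rw [Matrix.add_apply, mul_apply, mul_apply, ← Finset.sum_add_distrib]
  refine h.congr_of_eventuallyEq (.of_forall fun t => ?_)
  exact (congrFun₂ (hP t) i j).symm.trans (mul_apply ..)

lemma trace_eq_zero_of_hasDerivAt {n : Type*} [Fintype n]
    {P : ℝ → Matrix n n ℂ} {D : Matrix n n ℂ} {θ : ℝ} {c : ℂ} (hP : ∀ t, (P t).trace = c)
    (hD : ∀ i j, HasDerivAt (fun t => P t i j) (D i j) θ) : D.trace = 0 := by
  have h := HasDerivAt.fun_sum (u := Finset.univ) fun k _ => hD k k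
  refine h.unique ((hasDerivAt_const θ c).congr_of_eventuallyEq (.of_forall hP))

/-- Cayley–Hamilton for a traceless `2 × 2` matrix. -/
lemma mul_self_of_trace_eq_zero {D : Matrix (Fin 2) (Fin 2) ℂ} (hD : D.trace = 0) :
    D * D = ((D ^ 2).trace / 2) • (1 : Matrix (Fin 2) (Fin 2) ℂ) := by
  rw [trace_fin_two] at hD
  ext i j
  fin_cases i <;> fin_cases j <;>
    simp [pow_two, mul_apply, trace_fin_two, Fin.sum_univ_two]
  · linear_combination (D 0 0 - D 1 1) / 2 * hD
  · linear_combination D 0 1 * hD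
  · linear_combination D 1 0 * hD
  · linear_combination (D 1 1 - D 0 0) / 2 * hD

/-- The trace identity for a projection `P` of rank one and a tangent direction `D` at `P`. -/
lemma trace_mul_sq_of_tangent {P D : Matrix (Fin 2) (Fin 2) ℂ} (hP : P * P = P)
    (hPtr : P.trace = 1) (hD : D = D * P + P * D) (hDtr : D.trace = 0) (p a b c : ℂ) :
    ((p • P + (1 - p) • (1 - P)) * (a • P + b • D - c • (1 - P)) ^ 2).trace
      = p * a ^ 2 + (1 - p) * c ^ 2 + b ^ 2 * ((D ^ 2).trace / 2) := by
  have hDD := mul_self_of_trace_eq_zero hDtr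
  have hDP : D * P = D - P * D := eq_sub_of_add_eq hD.symm
  have hPDtr : (P * D).trace = 0 := by
    have h := congrArg trace hD
    rw [trace_add, trace_mul_comm D P] at h
    linear_combination (hDtr - h) / 2
  set κ := (D ^ 2).trace / 2
  have hL : (a • P + b • D - c • (1 - P)) ^ 2
      = (a ^ 2 - c ^ 2) • P + (b ^ 2 * κ + c ^ 2) • 1 + (b * (a - c)) • D := by
    rw [pow_two]
    simp only [mul_add, add_mul, mul_sub, sub_mul, smul_mul_assoc, mul_smul_comm, mul_one, one_mul,
      hP, hDD, hDP]
    module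
  rw [hL]
  simp only [mul_add, add_mul, sub_mul, smul_mul_assoc, mul_smul_comm, mul_one, one_mul,
    hP, trace_add, trace_sub, trace_smul, hPtr, hDtr, hPDtr, trace_one, Fintype.card_fin,
    smul_eq_mul]
  push_cast
  ring



/-- Lemma 2 (quantum information of a mixed state):
I(θ) = tr(ρ L²) = (w')²/(w(1−w)) + (2w−1)² I₁(θ), where I₁(θ) = 2 tr(ρ₁'²). -/
theorem mixed_state_quantum_info (ψ₁ ψ₂ : ℝ → Fin 2 → ℂ) (θ : ℝ)
    (hnorm₁ : ∀ t, star (ψ₁ t) ⬝ᵥ ψ₁ t = 1)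
    (hnorm₂ : ∀ t, star (ψ₂ t) ⬝ᵥ ψ₂ t = 1)
    (horth : ∀ t, star (ψ₁ t) ⬝ᵥ ψ₂ t = 0)
    (w : ℝ → ℝ) (w' : ℝ) (hw : ∀ t, 0 < w t ∧ w t < 1)
    (hw' : HasDerivAt w w' θ)
    (ρ₁ ρ₂ ρ : ℝ → Matrix (Fin 2) (Fin 2) ℂ)
    (hρ₁ : ∀ t, ρ₁ t = vecMulVec (ψ₁ t) (star (ψ₁ t)))
    (hρ₂ : ∀ t, ρ₂ t = vecMulVec (ψ₂ t) (star (ψ₂ t)))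
    (hρ : ∀ t, ρ t = (w t : ℂ) • ρ₁ t + ((1 - w t : ℝ) : ℂ) • ρ₂ t)
    (ρ₁' : Matrix (Fin 2) (Fin 2) ℂ)
    (hρ₁' : ∀ i j, HasDerivAt (fun t => ρ₁ t i j) (ρ₁' i j) θ)
    (I₁ : ℝ) (hI₁pos : 0 < I₁) (hI₁ : (2 : ℂ) * (ρ₁' ^ 2).trace = (I₁ : ℂ))
    (hψ₂ : ψ₂ θ = (((Real.sqrt I₁)⁻¹ : ℝ) : ℂ) • ((2 : ℂ) • ρ₁').mulVec (ψ₁ θ))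
    (L : Matrix (Fin 2) (Fin 2) ℂ)
    (hL : L = ((w' / w θ : ℝ) : ℂ) • ρ₁ θ + ((2 * w θ - 1 : ℝ) : ℂ) • ((2 : ℂ) • ρ₁')
        - ((w' / (1 - w θ) : ℝ) : ℂ) • ρ₂ θ) :
    (ρ θ * L ^ 2).trace
      = ((w' ^ 2 / (w θ * (1 - w θ)) + (2 * w θ - 1) ^ 2 * I₁ : ℝ) : ℂ) := by
  have hsum : ρ₁ θ + ρ₂ θ = 1 := by
    rw [hρ₁, hρ₂]
    exact vecMulVec_star_add_vecMulVec_star_eq_one (hnorm₁ θ) (hnorm₂ θ) (horth θ)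
  have hidem : ∀ t, ρ₁ t * ρ₁ t = ρ₁ t := fun t => by
    rw [hρ₁]
    exact vecMulVec_star_mul_self (hnorm₁ t)
  have htr : ∀ t, (ρ₁ t).trace = 1 := fun t => by
    rw [hρ₁, trace_vecMulVec, dotProduct_comm, hnorm₁]
  have hmain := trace_mul_sq_of_tangent (hidem θ) (htr θ)
    (eq_mul_add_mul_of_hasDerivAt_of_isIdempotentElem hidem hρ₁')
    (trace_eq_zero_of_hasDerivAt htr hρ₁')
    (w θ) (w' / w θ : ℝ) ((2 * w θ - 1 : ℝ) * 2) (w' / (1 - w θ) : ℝ)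
  have hw₀ : (w θ : ℂ) ≠ 0 := mod_cast (hw θ).1.ne'
  have hw₁ : (1 - w θ : ℂ) ≠ 0 := mod_cast (sub_pos.2 (hw θ).2).ne'
  rw [hρ, hL, eq_sub_of_add_eq' hsum, smul_smul, Complex.ofReal_sub 1, Complex.ofReal_one, hmain]
  push_cast
  rw [← hI₁]
  field_simp
  ring
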